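/- arXiv:2402.13819 — 5 statements merged into one kernel-verified Lean document; each statement's English description precedes it below -/
import Mathlib

section
/- Let r > 0 and let P(x,y,z) = a₀(x²+y²+z²)² + 2(b₁x+b₂y+b₃z)(x²+y²+z²) + c₁x² + c₂y² + c₃z² + 2d₁yz + 2d₂xz + 2d₃xy + 2e₁x + 2e₂y + 2e₃z + f₀ be a real polynomial (a general Darboux cyclide equation). Then P vanishes at every point of the circle Γ if and only if there exist real numbers u₀,u₁,u₂,u₃,u₄,v₁,v₂,v₃,v₄ such that P(x,y,z) = u₀(x²+y²+z²−r²)² + 2(x²+y²+z²−r²)(u₁x+u₂y+u₃z+u₄) + 2x(v₁x+v₂y+v₃z+v₄) holds identically in (x,y,z). -/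
/-- The general Darboux cyclide polynomial equation (1.2). -/
def darboux (a₀ b₁ b₂ b₃ c₁ c₂ c₃ d₁ d₂ d₃ e₁ e₂ e₃ f₀ x y z : ℝ) : ℝ :=
  a₀*(x^2+y^2+z^2)^2 + 2*(b₁*x+b₂*y+b₃*z)*(x^2+y^2+z^2)
  + c₁*x^2 + c₂*y^2 + c₃*z^2 + 2*d₁*y*z + 2*d₂*x*z + 2*d₃*x*y
  + 2*e₁*x + 2*e₂*y + 2*e₃*z + f₀

/-- A Darboux cyclide polynomial vanishes on the circle Γ = {x = 0, y² + z² = r²}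
iff it can be written in the form of Lemma 3.1. -/
theorem stmt0 (r : ℝ) (hr : 0 < r)
    (a₀ b₁ b₂ b₃ c₁ c₂ c₃ d₁ d₂ d₃ e₁ e₂ e₃ f₀ : ℝ) :
    (∀ y z : ℝ, y^2 + z^2 = r^2 →
      darboux a₀ b₁ b₂ b₃ c₁ c₂ c₃ d₁ d₂ d₃ e₁ e₂ e₃ f₀ 0 y z = 0)
    ↔ ∃ u₀ u₁ u₂ u₃ u₄ v₁ v₂ v₃ v₄ : ℝ, ∀ x y z : ℝ,
      darboux a₀ b₁ b₂ b₃ c₁ c₂ c₃ d₁ d₂ d₃ e₁ e₂ e₃ f₀ x y z =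
        u₀*(x^2+y^2+z^2-r^2)^2 + 2*(x^2+y^2+z^2-r^2)*(u₁*x+u₂*y+u₃*z+u₄)
        + 2*x*(v₁*x+v₂*y+v₃*z+v₄) := by
  constructor
  · intro h
    have h1 := h r 0 (by ring)
    have h2 := h (-r) 0 (by ring)
    have h3 := h 0 r (by ring)
    have h4 := h 0 (-r) (by ring)
    have h5 := h (3 / 5 * r) (4 / 5 * r) (by ring)
    simp only [darboux] at h1 h2 h3 h4 h5
    have he₂ : e₂ = -b₂ * r ^ 2 := mul_left_cancel₀ hr.ne' (by linear_combination (h1 - h2) / 4)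
    have he₃ : e₃ = -b₃ * r ^ 2 := mul_left_cancel₀ hr.ne' (by linear_combination (h3 - h4) / 4)
    have hc : c₃ = c₂ := mul_left_cancel₀ (pow_ne_zero 2 hr.ne')
      (by linear_combination (h3 + h4 - h1 - h2) / 2)
    have hf : f₀ = -a₀ * r ^ 4 - c₂ * r ^ 2 := by linear_combination (h1 + h2) / 2
    subst he₂ he₃ hc hf
    have hd : d₁ = 0 := mul_left_cancel₀ (pow_ne_zero 2 hr.ne')
      (by linear_combination 25 / 24 * h5)
    subst hd
    refine ⟨a₀, b₁, b₂, b₃, a₀ * r ^ 2 + c₃ / 2, (c₁ - c₃) / 2, d₃, d₂, e₁ + b₁ * r ^ 2, ?_⟩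
    intro x y z
    simp only [darboux]
    ring
  · rintro ⟨u₀, u₁, u₂, u₃, u₄, v₁, v₂, v₃, v₄, h⟩ y z hyz
    have hS : (0 : ℝ) ^ 2 + y ^ 2 + z ^ 2 - r ^ 2 = 0 := by linear_combination hyz
    rw [h, hS]
    ring
end

section
/- Let r > 0 and let u₁,u₂,u₃,u₄,v₂,v₃ be real numbers satisfying u₂v₂ + u₃v₃ = 2u₁u₄ and v₂² + v₃² = 4r²(u₁²+u₂²+u₃²) − 4u₄². Then u₄² ≤ r²(u₂² + u₃²). (In other words, if the inequality u₄² ≤ r²(u₂²+u₃²) fails, the last two Villarceau-component equations admit no real solution (v₂,v₃).) -/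
/-- If the last two Villarceau-component equations have a real solution (v₂, v₃),
then necessarily u₄² ≤ r²(u₂² + u₃²). -/
theorem stmt4 (r u₁ u₂ u₃ u₄ v₂ v₃ : ℝ) (hr : 0 < r)
    (h1 : u₂*v₂ + u₃*v₃ = 2*u₁*u₄)
    (h2 : v₂^2 + v₃^2 = 4*r^2*(u₁^2+u₂^2+u₃^2) - 4*u₄^2) :
    u₄^2 ≤ r^2*(u₂^2 + u₃^2) := by
  have key : (u₁^2 + (u₂^2 + u₃^2)) * (u₄^2 - r^2*(u₂^2 + u₃^2)) ≤ 0 := by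
    have cauchy : (u₂*v₂ + u₃*v₃)^2 ≤ (u₂^2 + u₃^2) * (v₂^2 + v₃^2) := by
      linarith [sq_nonneg (u₂*v₃ - u₃*v₂)]
    rw [h1, h2] at cauchy
    linarith
  have hnonneg : 0 ≤ u₁^2 + (u₂^2 + u₃^2) := by positivity
  rcases hnonneg.eq_or_lt with hzero | hpos
  · have hs : u₁^2 + u₂^2 + u₃^2 = 0 := by linarith
    rw [hs] at h2
    have hrhs : 0 ≤ r^2*(u₂^2 + u₃^2) := by positivity
    linarith [sq_nonneg v₂, sq_nonneg v₃]
  · exact sub_nonpos.mp (nonpos_of_mul_nonpos_right key hpos)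
end

section
/- Let r > 0 and let F and F′ be two polynomials of the stated form with real coefficients (u₀,…,v₄) and (u₀′,…,v₄′) respectively. Then the gradients ∇F and ∇F′ are parallel (i.e., their cross product is the zero vector) at every point (0,y,z) of the circle Γ if and only if (v₂y + v₃z + v₄)(u₂′y + u₃′z + u₄′) = (v₂′y + v₃′z + v₄′)(u₂y + u₃z + u₄) for every (y,z) with y² + z² = r². -/
/-- The Darboux cyclide equation through the circle Γ, Lemma 3.1. -/
def cyclF (u₀ u₁ u₂ u₃ u₄ v₁ v₂ v₃ v₄ r x y z : ℝ) : ℝ :=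
  u₀*(x^2+y^2+z^2-r^2)^2 + 2*(x^2+y^2+z^2-r^2)*(u₁*x+u₂*y+u₃*z+u₄)
  + 2*x*(v₁*x+v₂*y+v₃*z+v₄)

/-- The gradient of a function ℝ³ → ℝ, as a triple of partial derivatives. -/
noncomputable def grad3 (f : ℝ → ℝ → ℝ → ℝ) (x y z : ℝ) : ℝ × ℝ × ℝ :=
  (deriv (fun t => f t y z) x, deriv (fun t => f x t z) y, deriv (fun t => f x y t) z)

/-- The cross product on ℝ × ℝ × ℝ. -/
def cross3 (a b : ℝ × ℝ × ℝ) : ℝ × ℝ × ℝ :=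
  (a.2.1*b.2.2 - a.2.2*b.2.1, a.2.2*b.1 - a.1*b.2.2, a.1*b.2.1 - a.2.1*b.1)

/-- Along Γ the gradient of a cyclide equation only involves the two linear forms in `y`, `z`. -/
theorem grad3_cyclF (u₀ u₁ u₂ u₃ u₄ v₁ v₂ v₃ v₄ r y z : ℝ) (h : y^2 + z^2 = r^2) :
    grad3 (cyclF u₀ u₁ u₂ u₃ u₄ v₁ v₂ v₃ v₄ r) 0 y z
      = (2*(v₂*y+v₃*z+v₄), 4*y*(u₂*y+u₃*z+u₄), 4*z*(u₂*y+u₃*z+u₄)) := by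
  have key (p l m : ℝ → ℝ) (p' l' m' a : ℝ) (hp : HasDerivAt p p' a)
      (hl : HasDerivAt l l' a) (hm : HasDerivAt m m' a) (h0 : p a = 0) :
      deriv (fun t => u₀*(p t)^2 + 2*(p t)*(l t) + m t) a = 2*p'*l a + m' := by
    have hd := (((hp.pow 2).const_mul u₀).add ((hp.const_mul 2).mul hl)).add hm
    refine Eq.trans hd.deriv ?_
    simp [h0]
  have hsq (a : ℝ) : HasDerivAt (fun t : ℝ => t^2) (2*a) a := by
    simpa using hasDerivAt_pow 2 a
  have hlin (b c a : ℝ) : HasDerivAt (fun t : ℝ => b*t + c) b a := by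
    simpa using ((hasDerivAt_id a).const_mul b).add_const c
  have hp (c a : ℝ) : HasDerivAt (fun t : ℝ => t^2 + c) (2*a) a := (hsq a).add_const c
  have hm : HasDerivAt (fun t : ℝ => 2*v₁*t^2 + (2*(v₂*y+v₃*z+v₄)*t + 0))
      (2*v₁*(2*0) + 2*(v₂*y+v₃*z+v₄)) 0 := ((hsq 0).const_mul _).add (hlin _ _ 0)
  have hx := key _ _ _ _ _ _ 0 (hp (y^2+z^2-r^2) 0) (hlin u₁ (u₂*y+u₃*z+u₄) 0) hm
    (by linear_combination h)
  have hy := key _ _ _ _ _ _ y (hp (z^2-r^2) y) (hlin u₂ (u₃*z+u₄) y)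
    (hasDerivAt_const y 0) (by linear_combination h)
  have hz := key _ _ _ _ _ _ z (hp (y^2-r^2) z) (hlin u₃ (u₂*y+u₄) z)
    (hasDerivAt_const z 0) (by linear_combination h)
  unfold grad3 cyclF
  refine Prod.ext ?_ (Prod.ext ?_ ?_)
  · refine Eq.trans (congrArg (deriv · 0) (funext fun t => ?_)) (hx.trans ?_) <;> ring
  · refine Eq.trans (congrArg (deriv · y) (funext fun t => ?_)) (hy.trans ?_) <;> ring
  · refine Eq.trans (congrArg (deriv · z) (funext fun t => ?_)) (hz.trans ?_) <;> ring

/-- Two cyclide equations of the form of Lemma 3.1 are joined smoothly along Γ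
(parallel gradients at every point of Γ) iff
(v₂y+v₃z+v₄)(u₂′y+u₃′z+u₄′) = (v₂′y+v₃′z+v₄′)(u₂y+u₃z+u₄) on Γ (Lemma 6.1). -/
theorem stmt6 (r : ℝ) (hr : 0 < r)
    (u₀ u₁ u₂ u₃ u₄ v₁ v₂ v₃ v₄ : ℝ)
    (u₀' u₁' u₂' u₃' u₄' v₁' v₂' v₃' v₄' : ℝ) :
    (∀ y z : ℝ, y^2 + z^2 = r^2 →
      cross3 (grad3 (cyclF u₀ u₁ u₂ u₃ u₄ v₁ v₂ v₃ v₄ r) 0 y z)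
             (grad3 (cyclF u₀' u₁' u₂' u₃' u₄' v₁' v₂' v₃' v₄' r) 0 y z)
        = (0, 0, 0))
    ↔ (∀ y z : ℝ, y^2 + z^2 = r^2 →
      (v₂*y + v₃*z + v₄)*(u₂'*y + u₃'*z + u₄')
        = (v₂'*y + v₃'*z + v₄')*(u₂*y + u₃*z + u₄)) := by
  refine forall₃_congr fun y z h => ?_
  rw [grad3_cyclF _ _ _ _ _ _ _ _ _ r y z h, grad3_cyclF _ _ _ _ _ _ _ _ _ r y z h]
  simp only [cross3, Prod.mk.injEq]
  constructor
  · rintro ⟨-, h₂, h₃⟩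
    have hr2 : 8*r^2 ≠ 0 := by positivity
    refine mul_left_cancel₀ hr2 ?_
    rw [← h]
    linear_combination y*h₃ - z*h₂
  · intro e
    refine ⟨by ring, ?_, ?_⟩
    · linear_combination (-8*z)*e
    · linear_combination (8*y)*e
end

section
/- Let r > 0 and λ ∈ ℝ. For each φ ∈ ℝ, the straight line L_φ = { (0, r cos φ, r sin φ) + t(2r, −λ cos φ, −λ sin φ) : t ∈ ℝ } passes through the point (0, r cos φ, r sin φ) of the circle Γ, its direction vector (2r, −λ cos φ, −λ sin φ) is orthogonal both to the vector (λ, 2r cos φ, 2r sin φ) and to the tangent vector (0, −sin φ, cos φ) of Γ at that point, and L_φ is entirely contained in the surface { (x,y,z) : y² + z² = (r − λx/(2r))² }. Moreover, this surface (a circular cone when λ ≠ 0, a circular cylinder when λ = 0) is exactly the union of the lines L_φ over all φ ∈ ℝ. -/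
open Real

/-- A point of the plane at distance `|s|` from the origin has polar coordinates with the signed
radius `s`. -/
theorem exists_eq_mul_cos_and_eq_mul_sin {y z s : ℝ} (h : y ^ 2 + z ^ 2 = s ^ 2) :
    ∃ φ : ℝ, y = s * cos φ ∧ z = s * sin φ := by
  rcases eq_or_ne s 0 with rfl | hs
  · exact ⟨0, by nlinarith [sq_nonneg y, sq_nonneg z], by nlinarith [sq_nonneg y, sq_nonneg z]⟩
  · set w : ℂ := ⟨y / s, z / s⟩
    have hw : ‖w‖ = 1 := by
      rw [← sq_eq_sq₀ (norm_nonneg w) zero_le_one, Complex.sq_norm, Complex.normSq_mk]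
      field_simp
      linarith
    have hcos : cos w.arg = y / s := by simpa [hw] using Complex.norm_mul_cos_arg w
    have hsin : sin w.arg = z / s := by simpa [hw] using Complex.norm_mul_sin_arg w
    exact ⟨w.arg, by rw [hcos, mul_div_cancel₀ _ hs], by rw [hsin, mul_div_cancel₀ _ hs]⟩

/-- Lemma 6.2: for every φ the line L_φ through the circle point (0, r cos φ, r sin φ)
with direction (2r, −λ cos φ, −λ sin φ) is orthogonal to the rescaled gradient
(λ, 2r cos φ, 2r sin φ) and to the tangent of Γ, and lies on the surface
y² + z² = (r − λx/(2r))²; moreover this surface (a cone if λ ≠ 0, a cylinder if λ = 0)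
is exactly the union of these lines. -/
theorem stmt7 (r lam : ℝ) (hr : 0 < r) :
    (∀ φ : ℝ,
      -- L_φ passes through the point (0, r cos φ, r sin φ) of Γ (take t = 0)
      (∃ t : ℝ, ((0:ℝ), r*cos φ, r*sin φ)
          = (0 + t*(2*r), r*cos φ + t*(-lam*cos φ), r*sin φ + t*(-lam*sin φ)))
      -- the direction vector is orthogonal to (λ, 2r cos φ, 2r sin φ)
      ∧ (2*r)*lam + (-lam*cos φ)*(2*r*cos φ) + (-lam*sin φ)*(2*r*sin φ) = 0
      -- the direction vector is orthogonal to the tangent (0, −sin φ, cos φ) of Γ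
      ∧ (2*r)*0 + (-lam*cos φ)*(-sin φ) + (-lam*sin φ)*(cos φ) = 0
      -- L_φ is contained in the surface y² + z² = (r − λx/(2r))²
      ∧ (∀ t : ℝ,
          (r*cos φ + t*(-lam*cos φ))^2 + (r*sin φ + t*(-lam*sin φ))^2
            = (r - lam*(0 + t*(2*r))/(2*r))^2))
    -- the surface is exactly the union of the lines L_φ
    ∧ (∀ x y z : ℝ,
        y^2 + z^2 = (r - lam*x/(2*r))^2 ↔
          ∃ φ t : ℝ, x = 0 + t*(2*r) ∧ y = r*cos φ + t*(-lam*cos φ)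
            ∧ z = r*sin φ + t*(-lam*sin φ)) := by
  have hr' : r ≠ 0 := hr.ne'
  have mem_surface (φ t : ℝ) :
      (r*cos φ + t*(-lam*cos φ))^2 + (r*sin φ + t*(-lam*sin φ))^2
        = (r - lam*(0 + t*(2*r))/(2*r))^2 := by
    have hdiv : lam*(0 + t*(2*r))/(2*r) = lam*t := by field_simp; ring
    rw [hdiv]
    linear_combination (r - lam*t)^2 * sin_sq_add_cos_sq φ
  refine ⟨fun φ => ⟨⟨0, by simp⟩, ?_, by ring, mem_surface φ⟩, fun x y z => ⟨fun h => ?_, ?_⟩⟩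
  · linear_combination -(2*r*lam) * sin_sq_add_cos_sq φ
  · obtain ⟨φ, rfl, rfl⟩ := exists_eq_mul_cos_and_eq_mul_sin h
    exact ⟨φ, x/(2*r), by field_simp; ring, by ring, by ring⟩
  · rintro ⟨φ, t, rfl, rfl, rfl⟩
    exact mem_surface φ t
end

section
/- Let r > 0 and let (u₀,…,v₄) and (u₀′,…,v₄′) be two real coefficient tuples, each satisfying the four Villarceau-component equations and the nondegeneracy inequality (u₄² < r²(u₂²+u₃²) and u₄′² < r²(u₂′²+u₃′²), respectively, so in particular (v₂,v₃,v₄) ≠ (0,0,0)). Suppose the two surfaces are smoothly blended along Γ, i.e., (v₂y + v₃z + v₄)(u₂′y + u₃′z + u₄′) = (v₂′y + v₃′z + v₄′)(u₂y + u₃z + u₄) for all (y,z) with y² + z² = r². Then there exist real numbers s ≠ 0 and t such that (u₀′, u₁′, u₂′, u₃′, u₄′; v₁′, v₂′, v₃′, v₄′) = s·(u₀+t, u₁, u₂, u₃, u₄; v₁+2r²t, v₂, v₃, v₄); that is, up to rescaling, the second surface belongs to the pencil obtained by perturbing the first equation by multiples of (x²+y²+z²−r²)² + 4r²x². -/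
/-- A quadratic expression `P y² + Q y z + R z² + S y + T z + U` vanishing on the unit circle is a
multiple of `y² + z² - 1`. -/
lemma coeffs_of_vanish_on_unit_circle (P Q R S T U : ℝ)
    (h : ∀ y z : ℝ, y^2 + z^2 = 1 → P*y^2 + Q*(y*z) + R*z^2 + S*y + T*z + U = 0) :
    P = -U ∧ R = -U ∧ Q = 0 ∧ S = 0 ∧ T = 0 := by
  have e1 := h 1 0 (by norm_num)
  have e2 := h (-1) 0 (by norm_num)
  have e3 := h 0 1 (by norm_num)
  have e4 := h 0 (-1) (by norm_num)
  have e5 := h (3/5) (4/5) (by norm_num)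
  norm_num at e1 e2 e3 e4 e5
  refine ⟨?_, ?_, ?_, ?_, ?_⟩ <;> linarith

/-- Let `(a, b)` and `(a', b')` be pairs of vectors in Minkowski space, where `a` and `b` are
orthogonal and of equal positive square. If `b ⊙ a' - b' ⊙ a` is a multiple of the metric, then
`(a', b')` is a multiple of `(a, b)`. -/
lemma proportional_of_symm_prod_eq_metric (a₁ a₂ a₃ b₁ b₂ b₃ a₁' a₂' a₃' b₁' b₂' b₃' k : ℝ)
    (hq : 0 < a₁^2 + a₂^2 - a₃^2)
    (hb : b₁^2 + b₂^2 - b₃^2 = a₁^2 + a₂^2 - a₃^2)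
    (hab : a₁*b₁ + a₂*b₂ - a₃*b₃ = 0)
    (h11 : b₁*a₁' - b₁'*a₁ = k) (h22 : b₂*a₂' - b₂'*a₂ = k) (h33 : b₃*a₃' - b₃'*a₃ = -k)
    (h12 : b₁*a₂' + b₂*a₁' - b₁'*a₂ - b₂'*a₁ = 0)
    (h13 : b₁*a₃' + b₃*a₁' - b₁'*a₃ - b₃'*a₁ = 0)
    (h23 : b₂*a₃' + b₃*a₂' - b₂'*a₃ - b₃'*a₂ = 0) :
    ∃ s : ℝ, a₁' = s*a₁ ∧ a₂' = s*a₂ ∧ a₃' = s*a₃ ∧ b₁' = s*b₁ ∧ b₂' = s*b₂ ∧ b₃' = s*b₃ := by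
  obtain ⟨q, hqdef⟩ : ∃ q, q = a₁^2 + a₂^2 - a₃^2 := ⟨_, rfl⟩
  obtain ⟨A, hA⟩ : ∃ A, A = a₁*a₁' + a₂*a₂' - a₃*a₃' := ⟨_, rfl⟩
  obtain ⟨B, hB⟩ : ∃ B, B = b₁*b₁' + b₂*b₂' - b₃*b₃' := ⟨_, rfl⟩
  obtain ⟨C, hC⟩ : ∃ C, C = a₁*b₁' + a₂*b₂' - a₃*b₃' := ⟨_, rfl⟩
  obtain ⟨D, hD⟩ : ∃ D, D = a₁'*b₁ + a₂'*b₂ - a₃'*b₃ := ⟨_, rfl⟩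
  rw [← hqdef] at hq hb
  have hq0 : q ≠ 0 := hq.ne'
  have y1 : q*b₁' = A*b₁ - (C + 2*k)*a₁ := by
    rw [hqdef, hA, hC]
    linear_combination a₁'*hab - 2*a₁*h11 - a₂*h12 + a₃*h13
  have y2 : q*b₂' = A*b₂ - (C + 2*k)*a₂ := by
    rw [hqdef, hA, hC]
    linear_combination a₂'*hab - 2*a₂*h22 - a₁*h12 + a₃*h23
  have y3 : q*b₃' = A*b₃ - (C + 2*k)*a₃ := by
    rw [hqdef, hA, hC]
    linear_combination a₃'*hab + 2*a₃*h33 - a₁*h13 - a₂*h23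
  have x1 : q*a₁' = (2*k - D)*b₁ + B*a₁ := by
    rw [hD, hB]
    linear_combination -a₁'*hb + b₁'*hab + 2*b₁*h11 + b₂*h12 - b₃*h13
  have x2 : q*a₂' = (2*k - D)*b₂ + B*a₂ := by
    rw [hD, hB]
    linear_combination -a₂'*hb + b₂'*hab + 2*b₂*h22 + b₁*h12 - b₃*h23
  have x3 : q*a₃' = (2*k - D)*b₃ + B*a₃ := by
    rw [hD, hB]
    linear_combination -a₃'*hb + b₃'*hab - 2*b₃*h33 + b₁*h13 + b₂*h23
  have hBA : B = A := mul_left_cancel₀ hq0 (by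
    linear_combination q*hB + b₁*y1 + b₂*y2 - b₃*y3 + A*hb - (C + 2*k)*hab)
  have hCk : C = -k := mul_left_cancel₀ hq0 (by
    linear_combination (q*hC + a₁*y1 + a₂*y2 - a₃*y3 + A*hab + (C + 2*k)*hqdef)/2)
  have hDk : D = k := mul_left_cancel₀ hq0 (by
    linear_combination (q*hD + b₁*x1 + b₂*x2 - b₃*x3 + B*hab + (2*k - D)*hb)/2)
  have htrace : D - C = 3*k := by
    rw [hD, hC]
    linear_combination h11 + h22 - h33
  have hk : k = 0 := by linarith
  rw [hCk, hk] at y1 y2 y3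
  rw [hDk, hk, hBA] at x1 x2 x3
  refine ⟨A/q, ?_, ?_, ?_, ?_, ?_, ?_⟩ <;> field_simp <;> linarith

/-- Proposition 6.9 (second part): if two coefficient tuples both satisfy the four
Villarceau-component equations and the nondegeneracy inequality, and the two
surfaces are smoothly blended along Γ, then up to rescaling the second tuple is
obtained from the first by the pencil perturbation by (x²+y²+z²−r²)² + 4r²x². -/
theorem stmt12 (r : ℝ) (hr : 0 < r)
    (u₀ u₁ u₂ u₃ u₄ v₁ v₂ v₃ v₄ : ℝ)
    (u₀' u₁' u₂' u₃' u₄' v₁' v₂' v₃' v₄' : ℝ)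
    (h1 : v₄ - 2*r^2*u₁ = 0) (h2 : v₁ + 2*u₄ - 2*r^2*u₀ = 0)
    (h3 : u₂*v₂ + u₃*v₃ - 2*u₁*u₄ = 0)
    (h4 : 4*r^2*(u₁^2+u₂^2+u₃^2) - 4*u₄^2 - v₂^2 - v₃^2 = 0)
    (h5 : u₄^2 < r^2*(u₂^2+u₃^2))
    (h1' : v₄' - 2*r^2*u₁' = 0) (h2' : v₁' + 2*u₄' - 2*r^2*u₀' = 0)
    (h3' : u₂'*v₂' + u₃'*v₃' - 2*u₁'*u₄' = 0)
    (h4' : 4*r^2*(u₁'^2+u₂'^2+u₃'^2) - 4*u₄'^2 - v₂'^2 - v₃'^2 = 0)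
    (h5' : u₄'^2 < r^2*(u₂'^2+u₃'^2))
    (hblend : ∀ y z : ℝ, y^2 + z^2 = r^2 →
      (v₂*y + v₃*z + v₄)*(u₂'*y + u₃'*z + u₄')
        = (v₂'*y + v₃'*z + v₄')*(u₂*y + u₃*z + u₄)) :
    ∃ s t : ℝ, s ≠ 0 ∧
      u₀' = s*(u₀+t) ∧ u₁' = s*u₁ ∧ u₂' = s*u₂ ∧ u₃' = s*u₃ ∧ u₄' = s*u₄ ∧
      v₁' = s*(v₁+2*r^2*t) ∧ v₂' = s*v₂ ∧ v₃' = s*v₃ ∧ v₄' = s*v₄ := by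
  have hr0 : r ≠ 0 := hr.ne'
  obtain ⟨h11, h22, h12, h13, h23⟩ := coeffs_of_vanish_on_unit_circle
    (v₂/2*(r*u₂') - v₂'/2*(r*u₂))
    (v₂/2*(r*u₃') + v₃/2*(r*u₂') - v₂'/2*(r*u₃) - v₃'/2*(r*u₂))
    (v₃/2*(r*u₃') - v₃'/2*(r*u₃))
    (v₂/2*u₄' + r*u₁*(r*u₂') - v₂'/2*u₄ - r*u₁'*(r*u₂))
    (v₃/2*u₄' + r*u₁*(r*u₃') - v₃'/2*u₄ - r*u₁'*(r*u₃))
    (r*u₁*u₄' - r*u₁'*u₄) (fun y z hyz => mul_left_cancel₀ hr0 (by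
      have h := hblend (r*y) (r*z) (by linear_combination r^2*hyz)
      linear_combination h/2 - (r*u₂'*y + r*u₃'*z + u₄')/2*h1
        + (r*u₂*y + r*u₃*z + u₄)/2*h1'))
  obtain ⟨s, a1, a2, a3, b1, b2, b3⟩ := proportional_of_symm_prod_eq_metric
    (r*u₂) (r*u₃) u₄ (v₂/2) (v₃/2) (r*u₁) (r*u₂') (r*u₃') u₄' (v₂'/2) (v₃'/2) (r*u₁')
    (-(r*u₁*u₄' - r*u₁'*u₄)) (by linarith) (by linear_combination -h4/4)
    (by linear_combination r*h3/2) h11 h22 (by ring) h12 h13 h23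
  have e1 : u₁' = s*u₁ := mul_left_cancel₀ hr0 (by linear_combination b3)
  have e2 : u₂' = s*u₂ := mul_left_cancel₀ hr0 (by linear_combination a1)
  have e3 : u₃' = s*u₃ := mul_left_cancel₀ hr0 (by linear_combination a2)
  have hs : s ≠ 0 := by
    rintro rfl
    simp [e2, e3, a3] at h5'
  have e0 : u₀' = s*(u₀ + (u₀'/s - u₀)) := by field_simp; ring
  refine ⟨s, u₀'/s - u₀, hs, e0, e1, e2, e3, a3, ?_, ?_, ?_, ?_⟩
  · linear_combination h2' - s*h2 - 2*a3 + 2*r^2*e0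
  · linear_combination 2*b1
  · linear_combination 2*b2
  · linear_combination h1' - s*h1 + 2*r^2*e1
end
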